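/- Let g ∈ S₀(ℝ), let α, β > 0 be such that (g, αℤ×βℤ) is a frame sequence with canonical dual window γ, and let ν ∈ ℕ, ν ≥ 1. Let 𝒦 be the closed linear span of {T_{k/β} M_{ℓ/α} g : k, ℓ ∈ ℤ} and, for s = 0, …, ν−1, let ℒ_s be the closed linear span of {T_{k/β} M_{(ℓν+s)/α} g : k, ℓ ∈ ℤ}. If 𝒦 is the direct sum ℒ_0 ∔ ⋯ ∔ ℒ_{ν−1} (i.e. 𝒦 = ℒ_0 + ⋯ + ℒ_{ν−1} and ℒ_i ∩ (∑_{j ≠ i} ℒ_j) = {0} for every i), then for every s = 0, …, ν−1 one has (αβ)^{−1} ∑_{k,ℓ∈ℤ} ⟨M_{s/α} g, T_{k/β} M_{ℓν/α} γ⟩ T_{k/β} M_{ℓν/α} g = g for s = 0 and = 0 for s ≠ 0, where the sums converge unconditionally in L²(ℝ). -/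

import Mathlib

open MeasureTheory Complex Filter
open scoped ENNReal InnerProductSpace RealInnerProductSpace ComplexConjugate

noncomputable section

/-- The Hilbert space `L²(ℝ)` of complex-valued square-integrable functions. -/
abbrev L2 : Type := Lp ℂ 2 (volume : Measure ℝ)

lemma memLp_translate (a : ℝ) (f : L2) :
    MemLp (fun x : ℝ => f (x - a)) 2 (volume : Measure ℝ) :=
  (Lp.memLp f).comp_measurePreserving (measurePreserving_sub_right volume a)

lemma memLp_modulate (b : ℝ) (f : L2) :
    MemLp (fun x : ℝ => Complex.exp (2 * Real.pi * Complex.I * (b * x)) * f x) 2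
      (volume : Measure ℝ) := by
  refine MemLp.of_le (Lp.memLp f) ?_ ?_
  · exact (Complex.continuous_exp.comp (by fun_prop)).aestronglyMeasurable.mul
      (Lp.aestronglyMeasurable f)
  · filter_upwards with x
    have : Complex.exp (2 * Real.pi * Complex.I * (b * x))
        = Complex.exp ((2 * Real.pi * (b * x) : ℝ) * Complex.I) := by
      push_cast; ring_nf
    rw [norm_mul, this, Complex.norm_exp_ofReal_mul_I, one_mul]

/-- Translation `T_a` on `L²(ℝ)`: `(T_a f)(x) = f (x - a)`. -/
def Tr (a : ℝ) (f : L2) : L2 := (memLp_translate a f).toLp _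

/-- Modulation `M_b` on `L²(ℝ)`: `(M_b f)(x) = e^{2πibx} f x`. -/
def Mo (b : ℝ) (f : L2) : L2 := (memLp_modulate b f).toLp _

/-- Time-frequency shift `π(a,b) = T_a M_b`. -/
def tf (z : ℝ × ℝ) (f : L2) : L2 := Tr z.1 (Mo z.2 f)

/-- The closed linear span `𝒢(g,Λ)` of the Gabor system `(g,Λ)`. -/
def gaborSpan (g : L2) (Λ : Set (ℝ × ℝ)) : Set L2 :=
  closure (Submodule.span ℂ ((fun z => tf z g) '' Λ) : Set L2)

/-- `𝔍(𝒢)`: the set of time-frequency shifts leaving `𝒢` invariant. -/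
def stab (G : Set L2) : Set (ℝ × ℝ) := {z | ∀ f ∈ G, tf z f ∈ G}

/-- `Λ` is a lattice in `ℝ²` if `Λ = Aℤ²` for an invertible `2×2` matrix `A`. -/
def IsLattice (Λ : Set (ℝ × ℝ)) : Prop :=
  ∃ A : Matrix (Fin 2) (Fin 2) ℝ, IsUnit A.det ∧
    Λ = {p : ℝ × ℝ | ∃ k l : ℤ,
      p = (A 0 0 * k + A 0 1 * l, A 1 0 * k + A 1 1 * l)}

lemma memLp_gaussian : MemLp (fun x : ℝ => (Real.exp (-Real.pi * x ^ 2) : ℂ)) 2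
    (volume : Measure ℝ) := by
  rw [memLp_two_iff_integrable_sq_norm]
  · have h : Integrable (fun x : ℝ => Real.exp (-(2 * Real.pi) * x ^ 2)) volume :=
      integrable_exp_neg_mul_sq (by positivity)
    refine h.congr (Eventually.of_forall fun x => ?_)
    simp only [Complex.norm_real, Real.norm_eq_abs, Real.abs_exp, sq, ← Real.exp_add]
    ring_nf
  · exact (Complex.continuous_ofReal.comp (by fun_prop)).aestronglyMeasurable

/-- The Gaussian `φ(x) = e^{-πx²}` as an element of `L²(ℝ)`. -/
def gaussL2 : L2 := memLp_gaussian.toLp _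

/-- The Feichtinger algebra condition: `f ∈ S₀(ℝ)` iff `(a,b) ↦ ⟨f, π(a,b)φ⟩ ∈ L¹(ℝ²)`. -/
def InS0 (f : L2) : Prop :=
  Integrable (fun z : ℝ × ℝ => ⟪tf z gaussL2, f⟫_ℂ) (volume : Measure (ℝ × ℝ))

/-- `(g,Λ)` is a frame for its closed linear span. -/
def IsFrameSeq (g : L2) (Λ : Set (ℝ × ℝ)) : Prop :=
  ∃ A B : ℝ, 0 < A ∧ 0 < B ∧ ∀ f ∈ gaborSpan g Λ,
    A * ‖f‖ ^ 2 ≤ ∑' lam : Λ, ‖⟪tf (lam : ℝ × ℝ) g, f⟫_ℂ‖ ^ 2 ∧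
    ∑' lam : Λ, ‖⟪tf (lam : ℝ × ℝ) g, f⟫_ℂ‖ ^ 2 ≤ B * ‖f‖ ^ 2

/-- `(g,Λ)` is a frame for all of `L²(ℝ)`. -/
def IsFrameL2 (g : L2) (Λ : Set (ℝ × ℝ)) : Prop :=
  ∃ A B : ℝ, 0 < A ∧ 0 < B ∧ ∀ f : L2,
    A * ‖f‖ ^ 2 ≤ ∑' lam : Λ, ‖⟪tf (lam : ℝ × ℝ) g, f⟫_ℂ‖ ^ 2 ∧
    ∑' lam : Λ, ‖⟪tf (lam : ℝ × ℝ) g, f⟫_ℂ‖ ^ 2 ≤ B * ‖f‖ ^ 2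

/-- Euclidean ball of radius `ε` around `a ∈ ℝ²`. -/
def eball (ε : ℝ) (a : ℝ × ℝ) : Set (ℝ × ℝ) :=
  {x : ℝ × ℝ | Real.sqrt ((x.1 - a.1) ^ 2 + (x.2 - a.2) ^ 2) < ε}

/-- `B_ε(Δ) = ⋃_{a ∈ Δ} B_ε(a)`. -/
def eballSet (ε : ℝ) (Δ : Set (ℝ × ℝ)) : Set (ℝ × ℝ) := ⋃ a ∈ Δ, eball ε a

/-- The separable lattice `αℤ × βℤ`. -/
def sepLattice (α β : ℝ) : Set (ℝ × ℝ) :=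
  {p : ℝ × ℝ | ∃ k l : ℤ, p = (α * k, β * l)}


/-- `γ` is the canonical dual window of the frame sequence `(g, αℤ×βℤ)`:
`γ` belongs to `𝒢(g, αℤ×βℤ)` and `Sγ = g` for the frame operator `S`,
the defining series converging unconditionally in `L²`. -/
def IsDualWindow (g γ : L2) (α β : ℝ) : Prop :=
  γ ∈ gaborSpan g (sepLattice α β) ∧
  HasSum (fun lam : sepLattice α β =>
    ⟪tf (lam : ℝ × ℝ) g, γ⟫_ℂ • tf (lam : ℝ × ℝ) g) g

/-- The closed linear span `𝒦` of the adjoint system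
`{T_{k/β} M_{ℓ/α} g : k, ℓ ∈ ℤ}`, as a (closed) subspace. -/
def Ksub (g : L2) (α β : ℝ) : Submodule ℂ L2 :=
  (Submodule.span ℂ
    {f : L2 | ∃ k l : ℤ, f = tf ((k : ℝ) / β, (l : ℝ) / α) g}).topologicalClosure

/-- The closed linear span `ℒ_s` of `{T_{k/β} M_{(ℓν+s)/α} g : k, ℓ ∈ ℤ}`. -/
def Lsub (g : L2) (α β : ℝ) (ν s : ℕ) : Submodule ℂ L2 :=
  (Submodule.span ℂ
    {f : L2 | ∃ k l : ℤ,
      f = tf ((k : ℝ) / β, ((l : ℝ) * (ν : ℝ) + (s : ℝ)) / α) g}).topologicalClosure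

/-! ### Time-frequency shifts -/

/-- The character `x ↦ e^{2πix}` of the real line. -/
def expChar (x : ℝ) : ℂ := Complex.exp (2 * Real.pi * Complex.I * x)

lemma expChar_add (x y : ℝ) : expChar (x + y) = expChar x * expChar y := by
  simp only [expChar, ← Complex.exp_add]
  push_cast
  ring_nf

lemma norm_expChar (x : ℝ) : ‖expChar x‖ = 1 := by
  have : (2 * Real.pi * Complex.I * x : ℂ) = ((2 * Real.pi * x : ℝ) : ℂ) * Complex.I := by
    push_cast; ring
  rw [expChar, this, Complex.norm_exp_ofReal_mul_I]

lemma conj_expChar_mul_self (x : ℝ) : conj (expChar x) * expChar x = 1 := by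
  rw [← Complex.normSq_eq_conj_mul_self, Complex.normSq_eq_norm_sq, norm_expChar]
  simp

lemma conj_expChar (x : ℝ) : conj (expChar x) = expChar (-x) := by
  rw [expChar, ← Complex.exp_conj, expChar]
  simp [Complex.conj_ofNat]

lemma expChar_intCast (n : ℤ) : expChar n = 1 := by
  rw [expChar, Complex.exp_eq_one_iff]
  exact ⟨n, by push_cast; ring⟩

lemma expChar_zero : expChar 0 = 1 := by simp [expChar]

lemma coeFn_tf (z : ℝ × ℝ) (f : L2) :
    tf z f =ᵐ[volume] fun x => expChar (z.2 * (x - z.1)) * f (x - z.1) := by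
  have h₁ : tf z f =ᵐ[volume] fun x => Mo z.2 f (x - z.1) :=
    MemLp.coeFn_toLp (memLp_translate z.1 (Mo z.2 f))
  have h₂ : Mo z.2 f =ᵐ[volume] fun x => Complex.exp (2 * Real.pi * Complex.I * (z.2 * x)) * f x :=
    MemLp.coeFn_toLp (memLp_modulate z.2 f)
  have h₃ := (measurePreserving_sub_right volume z.1).quasiMeasurePreserving.ae_eq_comp h₂
  filter_upwards [h₁, h₃] with x hx hx'
  rw [hx]
  simpa [expChar, Function.comp_def] using hx'

lemma tf_tf (z w : ℝ × ℝ) (f : L2) :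
    tf z (tf w f) = expChar (z.2 * w.1) • tf (z + w) f := by
  apply Lp.ext
  have h := (measurePreserving_sub_right volume z.1).quasiMeasurePreserving.ae_eq_comp
    (coeFn_tf w f)
  filter_upwards [coeFn_tf z (tf w f), h, Lp.coeFn_smul (expChar (z.2 * w.1)) (tf (z + w) f),
    coeFn_tf (z + w) f] with x h₁ h₂ h₃ h₄
  simp only [Function.comp_def] at h₂
  rw [h₁, h₂, h₃, Pi.smul_apply, h₄, smul_eq_mul, Prod.fst_add, Prod.snd_add, sub_sub,
    ← mul_assoc, ← mul_assoc, ← expChar_add, ← expChar_add]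
  congr 2
  ring

lemma tf_zero (f : L2) : tf 0 f = f := by
  apply Lp.ext
  filter_upwards [coeFn_tf 0 f] with x h
  simpa [expChar_zero] using h

lemma tf_zero_left (b : ℝ) (f : L2) : tf (0, b) f = Mo b f := by
  apply Lp.ext
  have h₂ : Mo b f =ᵐ[volume] fun x => Complex.exp (2 * Real.pi * Complex.I * (b * x)) * f x :=
    MemLp.coeFn_toLp (memLp_modulate b f)
  filter_upwards [coeFn_tf (0, b) f, h₂] with x h h'
  rw [h, h']
  simp [expChar]

lemma inner_tf_tf (z : ℝ × ℝ) (f h : L2) : ⟪tf z f, tf z h⟫_ℂ = ⟪f, h⟫_ℂ := by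
  rw [L2.inner_def, L2.inner_def, ← integral_sub_right_eq_self (fun x => ⟪f x, h x⟫_ℂ) z.1]
  apply integral_congr_ae
  filter_upwards [coeFn_tf z f, coeFn_tf z h] with x h₁ h₂
  rw [h₁, h₂]
  simp only [RCLike.inner_apply, map_mul]
  linear_combination (h (x - z.1) * conj (f (x - z.1))) *
    conj_expChar_mul_self (z.2 * (x - z.1))

lemma norm_tf (z : ℝ × ℝ) (f : L2) : ‖tf z f‖ = ‖f‖ := by
  rw [@norm_eq_sqrt_re_inner ℂ, @norm_eq_sqrt_re_inner ℂ, inner_tf_tf]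

lemma inner_tf_left (z : ℝ × ℝ) (f h : L2) :
    ⟪tf z f, h⟫_ℂ = expChar (z.1 * z.2) * ⟪f, tf (-z) h⟫_ℂ := by
  rw [← inner_tf_tf z f (tf (-z) h), tf_tf, inner_smul_right, ← mul_assoc, ← expChar_add,
    add_neg_cancel, tf_zero, Prod.fst_neg]
  simp [mul_comm z.2 z.1, expChar_zero]

lemma inner_tf_right (z : ℝ × ℝ) (f h : L2) :
    ⟪f, tf z h⟫_ℂ = expChar (-(z.1 * z.2)) * ⟪tf (-z) f, h⟫_ℂ := by
  rw [inner_tf_left (-z), neg_neg, ← mul_assoc, ← expChar_add]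
  simp [expChar_zero]

lemma norm_inner_tf_left (z : ℝ × ℝ) (f h : L2) :
    ‖⟪tf z f, h⟫_ℂ‖ = ‖⟪f, tf (-z) h⟫_ℂ‖ := by
  rw [inner_tf_left, norm_mul, norm_expChar, one_mul]

lemma norm_inner_tf_right (z : ℝ × ℝ) (f h : L2) :
    ‖⟪f, tf z h⟫_ℂ‖ = ‖⟪tf (-z) f, h⟫_ℂ‖ := by
  rw [inner_tf_right, norm_mul, norm_expChar, one_mul]

lemma norm_inner_tf_tf (z w : ℝ × ℝ) (f h : L2) :
    ‖⟪tf z (tf w f), h⟫_ℂ‖ = ‖⟪tf (z + w) f, h⟫_ℂ‖ := by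
  rw [tf_tf, inner_smul_left, norm_mul, RCLike.norm_conj, norm_expChar, one_mul]

/-! ### Time-frequency shifts of the Gaussian -/

lemma coeFn_tf_gaussL2 (z : ℝ × ℝ) :
    tf z gaussL2 =ᵐ[volume]
      fun x => expChar (z.2 * (x - z.1)) * (Real.exp (-Real.pi * (x - z.1) ^ 2) : ℂ) := by
  have h : gaussL2 =ᵐ[volume] fun x : ℝ => (Real.exp (-Real.pi * x ^ 2) : ℂ) :=
    MemLp.coeFn_toLp _
  have h' := (measurePreserving_sub_right volume z.1).quasiMeasurePreserving.ae_eq_comp h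
  filter_upwards [coeFn_tf z gaussL2, h'] with x h₁ h₂
  simp only [Function.comp_def] at h₂
  rw [h₁, h₂]

/-- The inner product of two time-frequency shifts of the Gaussian, up to the factor `‖φ‖²`. -/
def gaussKernel (u w : ℝ × ℝ) : ℂ :=
  Complex.exp (-(Real.pi / 2) * ((u.1 - w.1) ^ 2 + (u.2 - w.2) ^ 2)
    + Real.pi * Complex.I * ((u.1 - w.1) * (u.2 + w.2)))

/-- The constant `‖φ‖²`. -/
def gaussConst : ℂ := (Real.pi / -(-(2 * Real.pi) : ℂ)) ^ (1 / 2 : ℂ)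

lemma gaussConst_eq : gaussConst = (((1 / 2 : ℝ) ^ (1 / 2 : ℝ) : ℝ) : ℂ) := by
  rw [gaussConst, Complex.ofReal_cpow (by norm_num)]
  congr 1
  · have : (Real.pi : ℂ) ≠ 0 := by exact_mod_cast Real.pi_ne_zero
    push_cast
    field_simp
  · push_cast; rfl

lemma gaussConst_ne_zero : gaussConst ≠ 0 := by
  rw [gaussConst_eq]
  exact_mod_cast (Real.rpow_pos_of_pos (by norm_num) _).ne'

lemma gaussConst_sq : gaussConst * gaussConst = 1 / 2 := by
  rw [gaussConst_eq, ← Complex.ofReal_mul, ← Real.rpow_add (by norm_num)]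
  norm_num

lemma inner_tf_gaussL2 (u w : ℝ × ℝ) :
    ⟪tf u gaussL2, tf w gaussL2⟫_ℂ = gaussConst * gaussKernel u w := by
  have hpi : (Real.pi : ℂ) ≠ 0 := by exact_mod_cast Real.pi_ne_zero
  have hre : (-(2 * Real.pi) : ℂ).re < 0 := by
    simp [Real.pi_pos]
  rw [L2.inner_def]
  have key := integral_cexp_quadratic hre
    (2 * Real.pi * (u.1 + w.1) + 2 * Real.pi * Complex.I * (w.2 - u.2))
    (-Real.pi * (u.1 ^ 2 + w.1 ^ 2) + 2 * Real.pi * Complex.I * (u.2 * u.1 - w.2 * w.1))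
  rw [gaussConst, gaussKernel]
  convert key using 1
  · apply integral_congr_ae
    filter_upwards [coeFn_tf_gaussL2 u, coeFn_tf_gaussL2 w] with x h₁ h₂
    rw [h₁, h₂, RCLike.inner_apply, map_mul, conj_expChar, expChar, expChar, Complex.conj_ofReal,
      Complex.ofReal_exp, Complex.ofReal_exp, ← Complex.exp_add, ← Complex.exp_add,
      ← Complex.exp_add]
    push_cast
    ring_nf
  · congr 2
    field_simp
    ring_nf
    simp only [Complex.I_sq]
    ring

lemma norm_gaussKernel (u w : ℝ × ℝ) :
    ‖gaussKernel u w‖ = Real.exp (-(Real.pi / 2) * (u.1 - w.1) ^ 2) *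
      Real.exp (-(Real.pi / 2) * (u.2 - w.2) ^ 2) := by
  rw [gaussKernel, Complex.norm_exp, ← Real.exp_add]
  congr 1
  have : (-(Real.pi / 2) * ((u.1 - w.1) ^ 2 + (u.2 - w.2) ^ 2)
    + Real.pi * Complex.I * ((u.1 - w.1) * (u.2 + w.2)) : ℂ) =
    ((-(Real.pi / 2) * ((u.1 - w.1) ^ 2 + (u.2 - w.2) ^ 2) : ℝ) : ℂ)
    + ((Real.pi * ((u.1 - w.1) * (u.2 + w.2)) : ℝ) : ℂ) * Complex.I := by
    push_cast; ring
  rw [this, Complex.add_re, Complex.re_ofReal_mul, Complex.I_re, Complex.ofReal_re]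
  ring

lemma ae_eq_zero_of_fourier_eq_zero {F : ℝ → ℂ} (hF : Integrable F volume)
    (h : ∀ w, FourierTransform.fourier F w = 0) : F =ᵐ[volume] 0 := by
  refine ae_eq_zero_of_integral_contDiff_smul_eq_zero hF.locallyIntegrable fun η hη hsupp => ?_
  have hη' : ContDiff ℝ (⊤ : ℕ∞) fun x => (η x : ℂ) := Complex.ofRealCLM.contDiff.comp hη
  have hsupp' : HasCompactSupport fun x => (η x : ℂ) :=
    hsupp.comp_left (g := fun t : ℝ => (t : ℂ)) Complex.ofReal_zero
  let ψ : SchwartzMap ℝ ℂ := hsupp'.toSchwartzMap hη'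
  let θ : SchwartzMap ℝ ℂ := FourierTransformInv.fourierInv ψ
  have hθ : ∀ x, FourierTransform.fourier (θ : ℝ → ℂ) x = η x := fun x => by
    have : FourierTransform.fourier θ = ψ := FourierTransform.fourier_fourierInv_eq ψ
    have h' := congrArg (fun ρ : SchwartzMap ℝ ℂ => ρ x) this
    simpa [SchwartzMap.fourier_coe] using! h'
  have key : ∫ ξ, FourierTransform.fourier (θ : ℝ → ℂ) ξ • F ξ
      = ∫ x, θ x • FourierTransform.fourier F x := by
    simpa using! VectorFourier.integral_fourierIntegral_smul_eq_flip (L := innerₗ ℝ)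
      Real.continuous_fourierChar continuous_inner θ.integrable hF
  simp only [hθ, h, smul_zero, integral_zero] at key
  simpa using key

lemma eq_zero_of_inner_tf_gaussL2_eq_zero {f : L2} (h : ∀ z, ⟪tf z gaussL2, f⟫_ℂ = 0) :
    f = 0 := by
  have hg : tf 0 gaussL2 =ᵐ[volume] fun x : ℝ => (Real.exp (-Real.pi * x ^ 2) : ℂ) := by
    rw [tf_zero]
    exact MemLp.coeFn_toLp memLp_gaussian
  have hint : Integrable (fun x : ℝ => (Real.exp (-Real.pi * x ^ 2) : ℂ) * f x) volume := by
    refine (L2.integrable_inner (𝕜 := ℂ) (tf 0 gaussL2) f).congr ?_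
    filter_upwards [hg] with x hx
    rw [hx, RCLike.inner_apply, Complex.conj_ofReal, mul_comm]
  have hzero := ae_eq_zero_of_fourier_eq_zero hint fun w => by
    rw [Real.fourier_real_eq_integral_exp_smul, ← h (0, w), L2.inner_def]
    apply integral_congr_ae
    filter_upwards [coeFn_tf_gaussL2 (0, w)] with x hx
    rw [hx, RCLike.inner_apply, map_mul, conj_expChar, expChar, Complex.conj_ofReal, smul_eq_mul]
    simp only [sub_zero]
    rw [mul_comm (f x), ← mul_assoc]
    push_cast
    ring_nf
  apply Lp.ext
  filter_upwards [hzero, Lp.coeFn_zero ℂ 2 (volume : Measure ℝ)] with x hx h0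
  rw [h0]
  simpa [Complex.exp_ne_zero] using hx

lemma ext_inner_tf_gaussL2 {f h : L2} (H : ∀ z, ⟪tf z gaussL2, f⟫_ℂ = ⟪tf z gaussL2, h⟫_ℂ) :
    f = h :=
  sub_eq_zero.1 <| eq_zero_of_inner_tf_gaussL2_eq_zero fun z => by
    rw [inner_sub_right, H, sub_self]

lemma continuous_gaussKernel_left (w : ℝ × ℝ) : Continuous fun u => gaussKernel u w := by
  unfold gaussKernel
  fun_prop

lemma continuous_tf_gaussL2 : Continuous fun z => tf z gaussL2 := by
  rw [continuous_iff_continuousAt]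
  intro w
  rw [ContinuousAt, tendsto_iff_norm_sub_tendsto_zero]
  have hsq : ∀ z, ‖tf z gaussL2 - tf w gaussL2‖ ^ 2
      = 2 * ‖gaussL2‖ ^ 2 - 2 * (gaussConst * gaussKernel z w).re := fun z => by
    rw [@norm_sub_sq ℂ, norm_tf, norm_tf, inner_tf_gaussL2]
    simp only [RCLike.re_to_complex]
    ring
  have hw : (gaussConst * gaussKernel w w).re = ‖gaussL2‖ ^ 2 := by
    rw [← inner_tf_gaussL2, inner_tf_tf, ← @inner_self_eq_norm_sq ℂ]
    rfl
  have hlim : Tendsto (fun z => ‖tf z gaussL2 - tf w gaussL2‖ ^ 2) (nhds w) (nhds 0) := by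
    simp only [hsq]
    have hc : Continuous fun z => 2 * ‖gaussL2‖ ^ 2 - 2 * (gaussConst * gaussKernel z w).re := by
      have := continuous_gaussKernel_left w
      fun_prop
    have h0 := hc.tendsto w
    rwa [hw, sub_self] at h0
  have := (Real.continuous_sqrt.tendsto 0).comp hlim
  simpa [Function.comp_def] using this

lemma gaussKernel_mul_gaussKernel (u z w : ℝ × ℝ) :
    gaussKernel u z * gaussKernel z w =
      Complex.exp (-(Real.pi : ℂ) * (z.1 : ℂ) ^ 2
        + Real.pi * (u.1 + w.1 + Complex.I * (w.2 - u.2)) * z.1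
        + (-(Real.pi / 2) * (u.1 ^ 2 + w.1 ^ 2)
          + Real.pi * Complex.I * (u.1 * u.2 - w.1 * w.2))) *
      Complex.exp (-(Real.pi : ℂ) * (z.2 : ℂ) ^ 2
        + Real.pi * (u.2 + w.2 + Complex.I * (u.1 - w.1)) * z.2
        + (-(Real.pi / 2) * (u.2 ^ 2 + w.2 ^ 2))) := by
  simp only [gaussKernel, ← Complex.exp_add]
  congr 1
  ring

lemma integral_gaussKernel_mul (u w : ℝ × ℝ) :
    ∫ z, gaussKernel u z * gaussKernel z w = gaussKernel u w := by
  have hpi : (Real.pi : ℂ) ≠ 0 := by exact_mod_cast Real.pi_ne_zero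
  have hre : (-(Real.pi : ℂ)).re < 0 := by simpa using Real.pi_pos
  have hone : ((Real.pi : ℂ) / - -(Real.pi : ℂ)) ^ (1 / 2 : ℂ) = 1 := by
    rw [neg_neg, div_self hpi, Complex.one_cpow]
  simp only [gaussKernel_mul_gaussKernel]
  rw [Measure.volume_eq_prod]
  refine (integral_prod_mul (fun x : ℝ => Complex.exp (-(Real.pi : ℂ) * (x : ℂ) ^ 2
        + Real.pi * (u.1 + w.1 + Complex.I * (w.2 - u.2)) * x
        + (-(Real.pi / 2) * (u.1 ^ 2 + w.1 ^ 2)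
          + Real.pi * Complex.I * (u.1 * u.2 - w.1 * w.2))))
    (fun y : ℝ => Complex.exp (-(Real.pi : ℂ) * (y : ℂ) ^ 2
        + Real.pi * (u.2 + w.2 + Complex.I * (u.1 - w.1)) * y
        + (-(Real.pi / 2) * (u.2 ^ 2 + w.2 ^ 2))))).trans ?_
  rw [integral_cexp_quadratic hre, integral_cexp_quadratic hre, hone, one_mul, one_mul,
    ← Complex.exp_add, gaussKernel]
  congr 1
  field_simp
  ring_nf
  simp only [Complex.I_sq]
  ring

lemma integrable_gaussKernel_left (w : ℝ × ℝ) :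
    Integrable (fun z => gaussKernel z w) volume := by
  have hb : 0 < Real.pi / 2 := by positivity
  have h (c : ℝ) : Integrable (fun x : ℝ => Real.exp (-(Real.pi / 2) * (x - c) ^ 2)) volume :=
    (integrable_exp_neg_mul_sq hb).comp_sub_right c
  refine Integrable.mono' ((h w.1).mul_prod (h w.2))
    (continuous_gaussKernel_left w).aestronglyMeasurable (Eventually.of_forall fun z => ?_)
  rw [norm_gaussKernel]

/-- The reproducing formula for the short-time Fourier transform of a time-frequency shift of the
Gaussian. -/
lemma integral_inner_smul_tf_gaussL2 (u : ℝ × ℝ) :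
    Integrable (fun z => ⟪tf z gaussL2, tf u gaussL2⟫_ℂ • tf z gaussL2) volume ∧
    ∫ z, ⟪tf z gaussL2, tf u gaussL2⟫_ℂ • tf z gaussL2 = gaussConst • tf u gaussL2 := by
  have hint : Integrable (fun z => ⟪tf z gaussL2, tf u gaussL2⟫_ℂ • tf z gaussL2) volume := by
    simp only [inner_tf_gaussL2]
    refine Integrable.mono' (((integrable_gaussKernel_left u).const_mul gaussConst).norm.mul_const
      ‖gaussL2‖) ?_ (Eventually.of_forall fun z => ?_)
    · exact (((continuous_gaussKernel_left u).const_smul gaussConst).smul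
        continuous_tf_gaussL2).aestronglyMeasurable
    · rw [norm_smul, norm_tf]
  refine ⟨hint, ext_inner_tf_gaussL2 fun w => ?_⟩
  rw [← integral_inner hint, inner_smul_right, inner_tf_gaussL2, ← integral_gaussKernel_mul,
    ← integral_const_mul, ← integral_const_mul]
  congr 1 with z
  rw [inner_smul_right, inner_tf_gaussL2, inner_tf_gaussL2]
  ring

/-- Inversion formula for the short-time Fourier transform with Gaussian window on `S₀(ℝ)`. -/
lemma InS0.integral_inner_mul_inner {g : L2} (hg : InS0 g) (f : L2) :
    ∫ z, ⟪tf z gaussL2, g⟫_ℂ * ⟪f, tf z gaussL2⟫_ℂ = gaussConst * ⟪f, g⟫_ℂ := by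
  have hint : Integrable (fun z => ⟪tf z gaussL2, g⟫_ℂ • tf z gaussL2) volume := by
    refine Integrable.mono' (hg.norm.mul_const ‖gaussL2‖) ?_ (Eventually.of_forall fun z => ?_)
    · exact hg.aestronglyMeasurable.smul continuous_tf_gaussL2.aestronglyMeasurable
    · rw [norm_smul, norm_tf]
  have hinv : ∫ z, ⟪tf z gaussL2, g⟫_ℂ • tf z gaussL2 = gaussConst • g := by
    refine ext_inner_tf_gaussL2 fun u => ?_
    have hconj : conj gaussConst = gaussConst := by rw [gaussConst_eq, Complex.conj_ofReal]
    obtain ⟨hu, hu'⟩ := integral_inner_smul_tf_gaussL2 u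
    have := congrArg (fun y => conj ⟪g, y⟫_ℂ) hu'
    simp only [← integral_inner hu, inner_smul_right, map_mul, inner_conj_symm, hconj,
      ← integral_conj] at this
    rw [← integral_inner hint, inner_smul_right, ← this]
    congr 1 with z
    rw [inner_smul_right, mul_comm]
  rw [← inner_smul_right, ← hinv, ← integral_inner hint]
  simp only [inner_smul_right]

/-! ### Bessel families -/

/-- A family of vectors in `L²(ℝ)` is a Bessel family if its analysis operator is bounded. -/
def IsBessel {ι : Type*} (v : ι → L2) : Prop :=
  ∃ B : ℝ, 0 ≤ B ∧ ∀ (f : L2) (F : Finset ι), ∑ i ∈ F, ‖⟪v i, f⟫_ℂ‖ ^ 2 ≤ B * ‖f‖ ^ 2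

lemma le_of_le_sqrt_mul {S B c : ℝ} (hS : 0 ≤ S) (hB : 0 ≤ B)
    (h : S ≤ √(B * S) * c) : S ≤ B * c ^ 2 := by
  rcases hS.eq_or_lt with rfl | hpos
  · positivity
  · have h2 : S ^ 2 ≤ (B * S) * c ^ 2 := by
      calc S ^ 2 ≤ (√(B * S) * c) ^ 2 := by gcongr
        _ = (B * S) * c ^ 2 := by rw [mul_pow, Real.sq_sqrt (by positivity)]
    nlinarith

section

variable {ι : Type*} {v : ι → L2}

/-- Schur's test for the Gram matrix. -/
lemma isBessel_of_gram_bound (B : ℝ) (hB : 0 ≤ B)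
    (h : ∀ (F : Finset ι) (i : ι), ∑ j ∈ F, ‖⟪v i, v j⟫_ℂ‖ ≤ B) : IsBessel v := by
  refine ⟨B, hB, fun f F => ?_⟩
  set c : ι → ℂ := fun i => ⟪v i, f⟫_ℂ with hc
  set x : L2 := ∑ i ∈ F, c i • v i with hx
  set S : ℝ := ∑ i ∈ F, ‖c i‖ ^ 2 with hS
  have hS0 : 0 ≤ S := by positivity
  have hinner : ⟪x, f⟫_ℂ = (S : ℂ) := by
    rw [hx, sum_inner, hS, Complex.ofReal_sum]
    refine Finset.sum_congr rfl fun i _ => ?_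
    rw [inner_smul_left, Complex.conj_mul']
    norm_cast
  have hnorm : ‖x‖ ^ 2 ≤ B * S := by
    have h1 : ‖x‖ ^ 2 ≤ ∑ i ∈ F, ∑ j ∈ F, ‖c i‖ * ‖c j‖ * ‖⟪v i, v j⟫_ℂ‖ := by
      have h2 : ‖x‖ ^ 2 = ‖⟪x, x⟫_ℂ‖ := by
        rw [inner_self_eq_norm_sq_to_K]; simp
      rw [h2, hx, sum_inner]
      refine (norm_sum_le _ _).trans (Finset.sum_le_sum fun i _ => ?_)
      rw [inner_sum]
      refine (norm_sum_le _ _).trans (Finset.sum_le_sum fun j _ => le_of_eq ?_)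
      rw [inner_smul_left, inner_smul_right, norm_mul, norm_mul, RCLike.norm_conj, mul_assoc]
    have h3 : ∑ i ∈ F, ∑ j ∈ F, ‖c i‖ * ‖c j‖ * ‖⟪v i, v j⟫_ℂ‖
        ≤ ∑ i ∈ F, ∑ j ∈ F, (‖c i‖ ^ 2 / 2 * ‖⟪v i, v j⟫_ℂ‖ + ‖c j‖ ^ 2 / 2 * ‖⟪v j, v i⟫_ℂ‖) := by
      refine Finset.sum_le_sum fun i _ => Finset.sum_le_sum fun j _ => ?_
      rw [norm_inner_symm (v j) (v i), ← add_mul]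
      gcongr
      nlinarith [sq_nonneg (‖c i‖ - ‖c j‖)]
    have h4 : ∑ i ∈ F, ∑ j ∈ F, ‖c i‖ ^ 2 / 2 * ‖⟪v i, v j⟫_ℂ‖ ≤ B * S / 2 := by
      rw [hS, Finset.mul_sum, Finset.sum_div]
      refine Finset.sum_le_sum fun i _ => ?_
      rw [← Finset.mul_sum]
      nlinarith [h F i, sq_nonneg ‖c i‖]
    have h5 : ∑ i ∈ F, ∑ j ∈ F, ‖c j‖ ^ 2 / 2 * ‖⟪v j, v i⟫_ℂ‖ ≤ B * S / 2 := by
      rw [Finset.sum_comm]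
      exact h4
    simp only [Finset.sum_add_distrib] at h3
    linarith
  refine le_of_le_sqrt_mul hS0 hB ?_
  calc S = ‖⟪x, f⟫_ℂ‖ := by rw [hinner, Complex.norm_real, Real.norm_of_nonneg hS0]
    _ ≤ ‖x‖ * ‖f‖ := norm_inner_le_norm _ _
    _ ≤ √(B * S) * ‖f‖ := by gcongr; exact Real.le_sqrt_of_sq_le hnorm

lemma IsBessel.summable_sq_norm_inner (hv : IsBessel v) (f : L2) :
    Summable fun i => ‖⟪v i, f⟫_ℂ‖ ^ 2 := by
  obtain ⟨B, -, h⟩ := hv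
  exact summable_of_sum_le (fun i => by positivity) (h f)

/-- The synthesis series of a Bessel family converges unconditionally for square-summable
coefficients. -/
lemma IsBessel.summable_smul (hv : IsBessel v) {c : ι → ℂ} (hc : Summable fun i => ‖c i‖ ^ 2) :
    Summable fun i => c i • v i := by
  obtain ⟨B, hB, h⟩ := hv
  have hbound : ∀ F : Finset ι, ‖∑ i ∈ F, c i • v i‖ ^ 2 ≤ B * ∑ i ∈ F, ‖c i‖ ^ 2 := fun F => by
    set x := ∑ i ∈ F, c i • v i with hx
    have h1 : ‖x‖ ^ 2 ≤ ∑ i ∈ F, ‖c i‖ * ‖⟪v i, x⟫_ℂ‖ := by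
      have h2 : ‖x‖ ^ 2 = ‖⟪x, x⟫_ℂ‖ := by
        rw [inner_self_eq_norm_sq_to_K]; simp
      rw [h2]
      conv_lhs => enter [1, 2]; rw [hx]
      rw [sum_inner]
      refine (norm_sum_le _ _).trans (Finset.sum_le_sum fun i _ => le_of_eq ?_)
      rw [inner_smul_left, norm_mul, RCLike.norm_conj]
    have h3 := Finset.sum_mul_sq_le_sq_mul_sq F (fun i => ‖c i‖) fun i => ‖⟪v i, x⟫_ℂ‖
    have h4 := h x F
    set S := ∑ i ∈ F, ‖c i‖ ^ 2
    have hS : 0 ≤ S := by positivity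
    have h5 : (‖x‖ ^ 2) ^ 2 ≤ (B * S) * ‖x‖ ^ 2 := by
      calc (‖x‖ ^ 2) ^ 2 ≤ (∑ i ∈ F, ‖c i‖ * ‖⟪v i, x⟫_ℂ‖) ^ 2 := by gcongr
        _ ≤ S * ∑ i ∈ F, ‖⟪v i, x⟫_ℂ‖ ^ 2 := h3
        _ ≤ S * (B * ‖x‖ ^ 2) := by gcongr
        _ = (B * S) * ‖x‖ ^ 2 := by ring
    rcases (sq_nonneg ‖x‖).eq_or_lt with h0 | hpos
    · rw [← h0]; positivity
    · nlinarith
  rw [summable_iff_vanishing_norm]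
  intro ε hε
  obtain ⟨s, hs⟩ := summable_iff_vanishing_norm.1 hc (ε ^ 2 / (B + 1)) (by positivity)
  refine ⟨s, fun t ht => ?_⟩
  have h1 := hs t ht
  rw [Real.norm_of_nonneg (by positivity), lt_div_iff₀ (by positivity)] at h1
  refine lt_of_pow_lt_pow_left₀ 2 hε.le ((hbound t).trans_lt ?_)
  have : 0 ≤ ∑ i ∈ t, ‖c i‖ ^ 2 := by positivity
  nlinarith

lemma IsBessel.of_norm_inner_eq {κ : Type*} (hv : IsBessel v) {w : κ → L2} (e : κ ↪ ι)
    (h : ∀ k f, ‖⟪w k, f⟫_ℂ‖ = ‖⟪v (e k), f⟫_ℂ‖) : IsBessel w := by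
  obtain ⟨B, hB, hb⟩ := hv
  refine ⟨B, hB, fun f F => ?_⟩
  have := hb f (F.map e)
  rw [Finset.sum_map] at this
  simpa only [h] using this

end

/-! ### Gabor systems over separable lattices -/

/-- The point of the separable lattice `pℤ × qℤ` with integer coordinates `n`. -/
def latticePoint (p q : ℝ) (n : ℤ × ℤ) : ℝ × ℝ := (p * n.1, q * n.2)

lemma latticePoint_add (p q : ℝ) (m n : ℤ × ℤ) :
    latticePoint p q (m + n) = latticePoint p q m + latticePoint p q n := by
  simp [latticePoint, mul_add]

lemma latticePoint_neg (p q : ℝ) (n : ℤ × ℤ) :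
    latticePoint p q (-n) = -latticePoint p q n := by
  simp [latticePoint]

lemma summable_cexp_quadratic {p : ℝ} (hp : 0 < p) (b : ℂ) :
    Summable fun n : ℤ => Complex.exp (-Real.pi * (p * n : ℂ) ^ 2 + 2 * Real.pi * b * (p * n)) := by
  have him : 0 < (Complex.I * (p : ℂ) ^ 2).im := by
    rw [← Complex.ofReal_pow, mul_comm, Complex.im_ofReal_mul, Complex.I_im]
    positivity
  refine ((summable_jacobiTheta₂_term_iff (-Complex.I * b * p) _).2 him).congr fun n => ?_
  rw [jacobiTheta₂_term]
  congr 1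
  linear_combination (Real.pi * (n : ℂ) ^ 2 * (p : ℂ) ^ 2 - 2 * Real.pi * n * b * p)
    * Complex.I_sq

lemma summable_rexp_neg_sq {p : ℝ} (hp : 0 < p) :
    Summable fun n : ℤ => Real.exp (-(Real.pi / 2) * (p * n) ^ 2) := by
  have hp' : 0 < p * √(1 / 2) := by positivity
  refine (summable_cexp_quadratic hp' 0).norm.congr fun n => ?_
  have : (-Real.pi * (((p * √(1 / 2) : ℝ) : ℂ) * n) ^ 2
      + 2 * Real.pi * 0 * (((p * √(1 / 2) : ℝ) : ℂ) * n) : ℂ)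
      = ((-(Real.pi / 2) * (p * n) ^ 2 : ℝ) : ℂ) := by
    have hs : ((√(1 / 2) : ℝ) : ℂ) ^ 2 = 1 / 2 := by
      rw [← Complex.ofReal_pow, Real.sq_sqrt (by norm_num)]
      norm_num
    push_cast at hs ⊢
    linear_combination (-Real.pi * (p * n) ^ 2 : ℂ) * hs
  rw [this, Complex.norm_exp, Complex.ofReal_re]

lemma isBessel_tf_gaussL2 {p q : ℝ} (hp : 0 < p) (hq : 0 < q) :
    IsBessel fun n => tf (latticePoint p q n) gaussL2 := by
  set G : ℤ × ℤ → ℝ := fun n => Real.exp (-(Real.pi / 2) * (p * n.1) ^ 2) *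
    Real.exp (-(Real.pi / 2) * (q * n.2) ^ 2) with hG
  have hsum : Summable G := (summable_rexp_neg_sq hp).mul_of_nonneg (summable_rexp_neg_sq hq)
    (fun _ => (Real.exp_pos _).le) fun _ => (Real.exp_pos _).le
  have hG0 : ∀ n, 0 ≤ G n := fun n => by positivity
  refine isBessel_of_gram_bound (‖gaussConst‖ * ∑' n, G n)
    (mul_nonneg (norm_nonneg _) (tsum_nonneg hG0)) fun F m => ?_
  have hterm : ∀ n, ‖⟪tf (latticePoint p q m) gaussL2, tf (latticePoint p q n) gaussL2⟫_ℂ‖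
      = ‖gaussConst‖ * G (Equiv.subLeft m n) := fun n => by
    rw [inner_tf_gaussL2, norm_mul, norm_gaussKernel, hG]
    simp only [latticePoint, Equiv.subLeft_apply, Prod.fst_sub, Prod.snd_sub]
    push_cast
    simp only [mul_sub]
  simp only [hterm]
  rw [← Finset.mul_sum]
  gcongr
  rw [← (Equiv.subLeft m).tsum_eq G]
  exact ((Equiv.subLeft m).summable_iff.2 hsum).sum_le_tsum F fun n _ => hG0 _

lemma isBessel_tf_tf_of_isBessel {p q : ℝ} {g : L2}
    (hg : IsBessel fun n => tf (latticePoint p q n) g) (z : ℝ × ℝ) :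
    IsBessel fun n => tf (latticePoint p q n) (tf z g) := by
  obtain ⟨B, hB, h⟩ := hg
  refine ⟨B, hB, fun f F => ?_⟩
  have hterm : ∀ n, ‖⟪tf (latticePoint p q n) (tf z g), f⟫_ℂ‖
      = ‖⟪tf (latticePoint p q n) g, tf (-z) f⟫_ℂ‖ := fun n => by
    rw [norm_inner_tf_tf, add_comm, ← norm_inner_tf_tf, norm_inner_tf_left]
  simpa only [hterm, norm_tf] using h (tf (-z) f) F

lemma isBessel_tf_neg {p q : ℝ} {g : L2} (hg : IsBessel fun n => tf (latticePoint p q n) g) :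
    IsBessel fun n => tf (-latticePoint p q n) g :=
  hg.of_norm_inner_eq (Equiv.neg _).toEmbedding fun n f => by
    simp [latticePoint_neg]

/-- Windows in the Feichtinger algebra generate Bessel families over separable lattices. -/
lemma InS0.isBessel {g : L2} (hg : InS0 g) {p q : ℝ} (hp : 0 < p) (hq : 0 < q) :
    IsBessel fun n => tf (latticePoint p q n) g := by
  obtain ⟨B, hB, hφ⟩ := isBessel_tf_gaussL2 hp hq
  set N : ℝ := ∫ z, ‖⟪tf z gaussL2, g⟫_ℂ‖ with hN
  have hN0 : 0 ≤ N := integral_nonneg fun z => norm_nonneg _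
  have hc : 0 < ‖gaussConst‖ := norm_pos_iff.2 gaussConst_ne_zero
  refine ⟨B * (N / ‖gaussConst‖) ^ 2, by positivity, fun f F => ?_⟩
  set a : ℤ × ℤ → ℝ := fun n => ‖⟪tf (latticePoint p q n) g, f⟫_ℂ‖ with ha
  set S : ℝ := ∑ n ∈ F, a n ^ 2 with hS
  have hS0 : 0 ≤ S := by positivity
  set u : ℤ × ℤ → ℝ × ℝ → ℝ := fun n z => ‖⟪tf (-latticePoint p q n) f, tf z gaussL2⟫_ℂ‖ with hu
  have hu' : ∀ n z, u n z = ‖⟪tf (latticePoint p q n) gaussL2, tf (-z) f⟫_ℂ‖ := fun n z => by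
    rw [hu]
    simp only
    rw [norm_inner_symm, ← norm_inner_tf_left, norm_inner_tf_tf, add_comm, ← norm_inner_tf_tf,
      norm_inner_tf_left]
  have hint : ∀ n, Integrable (fun z => ‖⟪tf z gaussL2, g⟫_ℂ‖ * u n z) volume := fun n => by
    refine hg.norm.mul_bdd (c := ‖f‖ * ‖gaussL2‖) ?_ (Eventually.of_forall fun z => ?_)
    · exact (Continuous.inner continuous_const
        continuous_tf_gaussL2).norm.aestronglyMeasurable
    · rw [hu, norm_norm]
      refine (norm_inner_le_norm _ _).trans_eq ?_
      rw [norm_tf, norm_tf]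
  have ha_le : ∀ n, ‖gaussConst‖ * a n ≤ ∫ z, ‖⟪tf z gaussL2, g⟫_ℂ‖ * u n z := fun n => by
    have h1 := hg.integral_inner_mul_inner (tf (-latticePoint p q n) f)
    have h2 : ‖gaussConst‖ * a n = ‖gaussConst * ⟪tf (-latticePoint p q n) f, g⟫_ℂ‖ := by
      rw [norm_mul, ← norm_inner_tf_right, ha, norm_inner_symm]
    rw [h2, ← h1]
    refine (norm_integral_le_integral_norm _).trans_eq ?_
    simp only [norm_mul, hu]
  have hpt : ∀ z, ∑ n ∈ F, a n * u n z ≤ √(B * S) * ‖f‖ := fun z => by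
    have h1 := Finset.sum_mul_sq_le_sq_mul_sq F a fun n => u n z
    have h2 := hφ (tf (-z) f) F
    rw [norm_tf] at h2
    simp only [← hu'] at h2
    refine (pow_le_pow_iff_left₀ (by positivity) (by positivity) two_ne_zero).1 (h1.trans ?_)
    rw [mul_pow, Real.sq_sqrt (by positivity)]
    calc S * ∑ n ∈ F, u n z ^ 2 ≤ S * (B * ‖f‖ ^ 2) := by gcongr
      _ = B * S * ‖f‖ ^ 2 := by ring
  have htotal : ‖gaussConst‖ * S ≤ N * (√(B * S) * ‖f‖) := by
    calc ‖gaussConst‖ * S = ∑ n ∈ F, a n * (‖gaussConst‖ * a n) := by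
          rw [hS, Finset.mul_sum]
          exact Finset.sum_congr rfl fun n _ => by ring
      _ ≤ ∑ n ∈ F, a n * ∫ z, ‖⟪tf z gaussL2, g⟫_ℂ‖ * u n z := by
          gcongr with n
          exact ha_le n
      _ = ∫ z, ‖⟪tf z gaussL2, g⟫_ℂ‖ * ∑ n ∈ F, a n * u n z := by
          simp only [← integral_const_mul]
          rw [← integral_finsetSum _ fun n _ => (hint n).const_mul (a n)]
          congr 1 with z
          rw [Finset.mul_sum]
          exact Finset.sum_congr rfl fun n _ => by ring
      _ ≤ ∫ z, ‖⟪tf z gaussL2, g⟫_ℂ‖ * (√(B * S) * ‖f‖) := by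
          refine integral_mono ?_ (hg.norm.mul_const _) fun z => ?_
          · have := integrable_finsetSum F fun n _ => (hint n).const_mul (a n)
            refine this.congr (Eventually.of_forall fun z => ?_)
            simp only
            rw [Finset.mul_sum]
            exact Finset.sum_congr rfl fun n _ => by ring
          · exact mul_le_mul_of_nonneg_left (hpt z) (norm_nonneg _)
      _ = N * (√(B * S) * ‖f‖) := by rw [integral_mul_const]
  have := le_of_le_sqrt_mul hS0 hB (c := N / ‖gaussConst‖ * ‖f‖) (by
    rw [div_mul_eq_mul_div, mul_div_assoc', le_div_iff₀ hc]
    linarith)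
  rwa [mul_pow, ← mul_assoc] at this

/-! ### The fundamental identity of Gabor analysis -/

/-- The sum `∑_λ ⟨f, π(λ)γ⟩ ⟨π(λ)g, h⟩` over the separable lattice `pℤ × qℤ`. -/
def gaborSum (p q : ℝ) (γ h f g : L2) : ℂ :=
  ∑' n, ⟪tf (latticePoint p q n) γ, f⟫_ℂ * ⟪h, tf (latticePoint p q n) g⟫_ℂ

/-- A theta series attached to the lattice `pℤ`. -/
def thetaSum (p : ℝ) (b : ℂ) : ℂ :=
  ∑' n : ℤ, Complex.exp (-Real.pi * (p * n : ℂ) ^ 2 + 2 * Real.pi * b * (p * n))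

lemma thetaSum_neg (p : ℝ) (b : ℂ) : thetaSum p (-b) = thetaSum p b := by
  rw [thetaSum, ← (Equiv.neg ℤ).tsum_eq, thetaSum]
  congr 1 with n
  simp

lemma thetaSum_eq {p : ℝ} (hp : 0 < p) (b : ℂ) :
    thetaSum p b = (p : ℂ)⁻¹ * Complex.exp (Real.pi * b ^ 2) * thetaSum p⁻¹ (Complex.I * b) := by
  have hpc : (p : ℂ) ≠ 0 := by exact_mod_cast hp.ne'
  have ha : 0 < ((p : ℂ) ^ 2).re := by
    rw [← Complex.ofReal_pow, Complex.ofReal_re]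
    positivity
  have hroot : ((p : ℂ) ^ 2) ^ (1 / 2 : ℂ) = p := by
    have := Complex.ofReal_cpow (sq_nonneg p) (1 / 2)
    rw [← Real.sqrt_eq_rpow, Real.sqrt_sq hp.le] at this
    push_cast at this
    exact this.symm
  have key := Complex.tsum_exp_neg_quadratic ha (p * b)
  rw [hroot] at key
  rw [← thetaSum_neg p⁻¹, thetaSum, thetaSum, mul_assoc (p : ℂ)⁻¹, ← tsum_mul_left]
  convert key using 1
  · congr 1 with n
    ring_nf
  · rw [one_div]
    congr 1
    refine tsum_congr fun n => ?_
    rw [← Complex.exp_add]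
    congr 1
    push_cast
    field_simp
    ring_nf
    simp only [Complex.I_sq]
    ring

lemma inner_mul_inner_tf_gaussL2 (l u v w t : ℝ × ℝ) :
    ⟪tf l (tf w gaussL2), tf u gaussL2⟫_ℂ * ⟪tf t gaussL2, tf l (tf v gaussL2)⟫_ℂ =
      (1 / 2 * (gaussKernel w u * gaussKernel t v)) *
      (Complex.exp (-Real.pi * (l.1 : ℂ) ^ 2 + 2 * Real.pi *
          ((u.1 - w.1 + t.1 - v.1 + Complex.I * (w.2 + u.2 - t.2 - v.2)) / 2) * l.1) *
        Complex.exp (-Real.pi * (l.2 : ℂ) ^ 2 + 2 * Real.pi *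
          ((u.2 - w.2 + t.2 - v.2 + Complex.I * (v.1 - w.1 - u.1 + t.1)) / 2) * l.2)) := by
  rw [tf_tf, tf_tf, inner_smul_left, inner_smul_right, inner_tf_gaussL2, inner_tf_gaussL2,
    conj_expChar, ← gaussConst_sq]
  simp only [gaussKernel, expChar]
  have hrearrange (a c d e : ℂ) : a * (gaussConst * c) * (d * (gaussConst * e))
      = gaussConst * gaussConst * (a * d * (c * e)) := by ring
  rw [hrearrange, mul_assoc (gaussConst * gaussConst)]
  simp only [← Complex.exp_add]
  congr 2
  simp only [Prod.fst_add, Prod.snd_add]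
  push_cast
  ring

lemma gaborSum_tf_gaussL2 {p q : ℝ} (hp : 0 < p) (hq : 0 < q) (u v w t : ℝ × ℝ) :
    gaborSum p q (tf w gaussL2) (tf t gaussL2) (tf u gaussL2) (tf v gaussL2) =
      (1 / 2 * (gaussKernel w u * gaussKernel t v)) *
      (thetaSum p ((u.1 - w.1 + t.1 - v.1 + Complex.I * (w.2 + u.2 - t.2 - v.2)) / 2) *
        thetaSum q ((u.2 - w.2 + t.2 - v.2 + Complex.I * (v.1 - w.1 - u.1 + t.1)) / 2)) := by
  simp only [gaborSum, inner_mul_inner_tf_gaussL2]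
  rw [tsum_mul_left, thetaSum, thetaSum, tsum_mul_tsum_of_summable_norm
    (summable_cexp_quadratic hp _).norm (summable_cexp_quadratic hq _).norm]
  simp only [latticePoint]
  push_cast
  rfl

lemma gaborSum_tf_gaussL2_eq_dual {p q : ℝ} (hp : 0 < p) (hq : 0 < q) (u v w t : ℝ × ℝ) :
    gaborSum p q (tf w gaussL2) (tf t gaussL2) (tf u gaussL2) (tf v gaussL2) =
      (((p * q)⁻¹ : ℝ) : ℂ) *
      gaborSum q⁻¹ p⁻¹ (tf w gaussL2) (tf t gaussL2) (tf v gaussL2) (tf u gaussL2) := by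
  rw [gaborSum_tf_gaussL2 hp hq, gaborSum_tf_gaussL2 (inv_pos.2 hq) (inv_pos.2 hp),
    thetaSum_eq hp, thetaSum_eq hq, ← thetaSum_neg q⁻¹]
  have h₁ : Complex.I * (((u.1 : ℂ) - w.1 + t.1 - v.1
      + Complex.I * (w.2 + u.2 - t.2 - v.2)) / 2)
      = (v.2 - w.2 + t.2 - u.2 + Complex.I * (u.1 - w.1 - v.1 + t.1)) / 2 := by
    linear_combination ((w.2 + u.2 - t.2 - v.2 : ℂ) / 2) * Complex.I_sq
  have h₂ : -(Complex.I * (((u.2 : ℂ) - w.2 + t.2 - v.2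
      + Complex.I * (v.1 - w.1 - u.1 + t.1)) / 2))
      = (v.1 - w.1 + t.1 - u.1 + Complex.I * (w.2 + v.2 - t.2 - u.2)) / 2 := by
    linear_combination (-(v.1 - w.1 - u.1 + t.1 : ℂ) / 2) * Complex.I_sq
  rw [h₁, h₂]
  have hker : gaussKernel w u * gaussKernel t v *
      (Complex.exp (Real.pi * (((u.1 : ℂ) - w.1 + t.1 - v.1
        + Complex.I * (w.2 + u.2 - t.2 - v.2)) / 2) ^ 2) *
      Complex.exp (Real.pi * (((u.2 : ℂ) - w.2 + t.2 - v.2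
        + Complex.I * (v.1 - w.1 - u.1 + t.1)) / 2) ^ 2)) =
      gaussKernel w v * gaussKernel t u := by
    simp only [gaussKernel, ← Complex.exp_add]
    congr 1
    ring_nf
    simp only [Complex.I_sq]
    ring
  rw [← hker]
  push_cast
  rw [mul_inv]
  ring

lemma summable_sq_norm_inner_tf_right {p q : ℝ} {h : L2}
    (hh : IsBessel fun n => tf (latticePoint p q n) h) (g : L2) :
    Summable fun n => ‖⟪h, tf (latticePoint p q n) g⟫_ℂ‖ ^ 2 := by
  simpa only [norm_inner_tf_right] using (isBessel_tf_neg hh).summable_sq_norm_inner g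

lemma IsBessel.exists_tsum_mul_inner_eq {ι : Type*} {v : ι → L2} (hv : IsBessel v) {c : ι → ℂ}
    (hc : Summable fun i => ‖c i‖ ^ 2) :
    ∃ X : L2, ∀ f, ∑' i, c i * ⟪f, v i⟫_ℂ = ⟪f, X⟫_ℂ := by
  refine ⟨∑' i, c i • v i, fun f => ?_⟩
  have := (hv.summable_smul hc).hasSum.mapL (innerSL ℂ f)
  simpa [inner_smul_right] using this.tsum_eq

lemma IsBessel.exists_tsum_mul_inner_eq' {ι : Type*} {v : ι → L2} (hv : IsBessel v) {c : ι → ℂ}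
    (hc : Summable fun i => ‖c i‖ ^ 2) :
    ∃ X : L2, ∀ f, ∑' i, c i * ⟪v i, f⟫_ℂ = ⟪X, f⟫_ℂ := by
  obtain ⟨X, hX⟩ := hv.exists_tsum_mul_inner_eq (c := fun i => conj (c i))
    (by simpa only [RCLike.norm_conj] using hc)
  refine ⟨X, fun f => ?_⟩
  rw [← inner_conj_symm, ← hX, Complex.conj_tsum]
  simp

lemma exists_gaborSum_eq_inner_fst {p q : ℝ} {γ h : L2}
    (hγ : IsBessel fun n => tf (latticePoint p q n) γ)
    (hh : IsBessel fun n => tf (latticePoint p q n) h) (g : L2) :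
    ∃ X : L2, ∀ f, gaborSum p q γ h f g = ⟪X, f⟫_ℂ := by
  obtain ⟨X, hX⟩ := hγ.exists_tsum_mul_inner_eq' (summable_sq_norm_inner_tf_right hh g)
  exact ⟨X, fun f => by simp only [← hX, gaborSum, mul_comm]⟩

lemma exists_gaborSum_eq_inner_snd {p q : ℝ} {γ h : L2}
    (hγ : IsBessel fun n => tf (latticePoint p q n) γ)
    (hh : IsBessel fun n => tf (latticePoint p q n) h) (f : L2) :
    ∃ X : L2, ∀ g, gaborSum p q γ h f g = ⟪X, g⟫_ℂ := by
  obtain ⟨X, hX⟩ := (isBessel_tf_neg hh).exists_tsum_mul_inner_eq'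
    (c := fun n => ⟪tf (latticePoint p q n) γ, f⟫_ℂ *
      expChar (-((latticePoint p q n).1 * (latticePoint p q n).2)))
    (by simpa only [norm_mul, norm_expChar, mul_one] using hγ.summable_sq_norm_inner f)
  refine ⟨X, fun g => ?_⟩
  rw [← hX, gaborSum]
  congr 1 with n
  rw [inner_tf_right, mul_assoc]

lemma exists_gaborSum_eq_inner_dual {p q : ℝ} {f h : L2}
    (hf : IsBessel fun n => tf (latticePoint p q n) f)
    (hh : IsBessel fun n => tf (latticePoint p q n) h) (g : L2) :
    ∃ X : L2, ∀ γ, gaborSum p q γ h f g = ⟪γ, X⟫_ℂ := by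
  obtain ⟨X, hX⟩ := (isBessel_tf_neg hf).exists_tsum_mul_inner_eq
    (c := fun n => ⟪h, tf (latticePoint p q n) g⟫_ℂ *
      expChar ((latticePoint p q n).1 * (latticePoint p q n).2))
    (by simpa only [norm_mul, norm_expChar, mul_one] using summable_sq_norm_inner_tf_right hh g)
  refine ⟨X, fun γ => ?_⟩
  rw [← hX, gaborSum]
  congr 1 with n
  rw [inner_tf_left]
  ring

lemma forall_inner_left_eq {X Y : L2} {κ : ℂ}
    (H : ∀ z, ⟪X, tf z gaussL2⟫_ℂ = κ * ⟪Y, tf z gaussL2⟫_ℂ) (f : L2) :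
    ⟪X, f⟫_ℂ = κ * ⟪Y, f⟫_ℂ := by
  have : X = conj κ • Y := ext_inner_tf_gaussL2 fun z => by
    rw [← inner_conj_symm, H, inner_smul_right, map_mul, inner_conj_symm]
  rw [this, inner_smul_left, Complex.conj_conj]

/-- The fundamental identity of Gabor analysis, tested against time-frequency shifts of the
Gaussian. -/
lemma gaborSum_eq_dual {p q : ℝ} (hp : 0 < p) (hq : 0 < q) {f g : L2}
    (hf : IsBessel fun n => tf (latticePoint p q n) f)
    (hg : IsBessel fun n => tf (latticePoint q⁻¹ p⁻¹ n) g) (γ : L2) (t : ℝ × ℝ) :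
    gaborSum p q γ (tf t gaussL2) f g =
      (((p * q)⁻¹ : ℝ) : ℂ) * gaborSum q⁻¹ p⁻¹ γ (tf t gaussL2) g f := by
  have hφ (z : ℝ × ℝ) := isBessel_tf_tf_of_isBessel (isBessel_tf_gaussL2 hp hq) z
  have hφ' (z : ℝ × ℝ) :=
    isBessel_tf_tf_of_isBessel (isBessel_tf_gaussL2 (inv_pos.2 hq) (inv_pos.2 hp)) z
  have hfst (w v : ℝ × ℝ) (f : L2) :
      gaborSum p q (tf w gaussL2) (tf t gaussL2) f (tf v gaussL2) = (((p * q)⁻¹ : ℝ) : ℂ) *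
        gaborSum q⁻¹ p⁻¹ (tf w gaussL2) (tf t gaussL2) (tf v gaussL2) f := by
    obtain ⟨X, hX⟩ := exists_gaborSum_eq_inner_fst (hφ w) (hφ t) (tf v gaussL2)
    obtain ⟨Y, hY⟩ := exists_gaborSum_eq_inner_snd (hφ' w) (hφ' t) (tf v gaussL2)
    rw [hX, hY]
    refine forall_inner_left_eq (fun u => ?_) f
    rw [← hX, ← hY, gaborSum_tf_gaussL2_eq_dual hp hq]
  have hsnd (w : ℝ × ℝ) (f g : L2) :
      gaborSum p q (tf w gaussL2) (tf t gaussL2) f g = (((p * q)⁻¹ : ℝ) : ℂ) *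
        gaborSum q⁻¹ p⁻¹ (tf w gaussL2) (tf t gaussL2) g f := by
    obtain ⟨X, hX⟩ := exists_gaborSum_eq_inner_snd (hφ w) (hφ t) f
    obtain ⟨Y, hY⟩ := exists_gaborSum_eq_inner_fst (hφ' w) (hφ' t) f
    rw [hX, hY]
    refine forall_inner_left_eq (fun v => ?_) g
    rw [← hX, ← hY, hfst]
  obtain ⟨X, hX⟩ := exists_gaborSum_eq_inner_dual hf (hφ t) g
  obtain ⟨Y, hY⟩ := exists_gaborSum_eq_inner_dual hg (hφ' t) f
  rw [hX, hY, ← inner_smul_right]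
  congr 1
  refine ext_inner_tf_gaussL2 fun w => ?_
  rw [inner_smul_right, ← hX, ← hY, hsnd]

/-! ### Expansions with respect to the adjoint lattice -/

/-- Self-adjointness of the frame operator at the canonical dual window. -/
lemma inner_tf_dual_window {p q : ℝ} {g γ : L2}
    (hγ : HasSum (fun n => ⟪tf (latticePoint p q n) g, γ⟫_ℂ • tf (latticePoint p q n) g) g)
    (m : ℤ × ℤ) :
    ⟪tf (latticePoint p q m) γ, g⟫_ℂ = ⟪tf (latticePoint p q m) g, γ⟫_ℂ := by
  have hinner (y : L2) : HasSum (fun n => ⟪tf (latticePoint p q n) g, γ⟫_ℂ *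
      ⟪y, tf (latticePoint p q n) g⟫_ℂ) ⟪y, g⟫_ℂ := by
    simpa [inner_smul_right] using hγ.mapL (innerSL ℂ y)
  have h₁ := (Equiv.addLeft m).hasSum_iff.2 (hinner (tf (latticePoint p q m) γ))
  have h₂ := (Complex.hasSum_conj'.2 (hinner (tf (-latticePoint p q m) γ))).mul_left
    (expChar ((latticePoint p q m).1 * (latticePoint p q m).2))
  rw [inner_conj_symm, ← inner_tf_left] at h₂
  refine h₁.unique (h₂.congr_fun fun n => ?_)
  rw [map_mul, inner_conj_symm, inner_conj_symm, mul_left_comm, ← inner_tf_left,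
    ← inner_tf_tf (latticePoint p q m) γ, tf_tf, inner_smul_left, inner_smul_right,
    Function.comp_apply, Equiv.coe_addLeft, latticePoint_add]
  linear_combination (-⟪tf (latticePoint p q m) γ,
    tf (latticePoint p q m + latticePoint p q n) g⟫_ℂ *
    ⟪tf (latticePoint p q m + latticePoint p q n) g, γ⟫_ℂ) *
    conj_expChar_mul_self ((latticePoint p q m).2 * (latticePoint p q n).1)

lemma hasSum_adjoint_lattice {g γ : L2} (hg : InS0 g) {α β : ℝ} (hα : 0 < α) (hβ : 0 < β)
    (hγ : HasSum (fun n => ⟪tf (latticePoint α β n) g, γ⟫_ℂ • tf (latticePoint α β n) g) g)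
    (s : ℤ) :
    HasSum (fun n => ((((α * β)⁻¹ : ℝ) : ℂ) *
        ⟪tf (latticePoint β⁻¹ α⁻¹ n) γ, Mo (s / α) g⟫_ℂ) • tf (latticePoint β⁻¹ α⁻¹ n) g)
      (Mo (s / α) g) := by
  rw [← tf_zero_left]
  set b : ℝ × ℝ := (0, s / α) with hb
  have hB := hg.isBessel (inv_pos.2 hβ) (inv_pos.2 hα)
  have hBb := isBessel_tf_tf_of_isBessel hB b
  have hc : Summable fun n => ‖(((α * β)⁻¹ : ℝ) : ℂ) *
      ⟪tf (latticePoint β⁻¹ α⁻¹ n) γ, tf b g⟫_ℂ‖ ^ 2 := by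
    simp only [norm_mul, mul_pow, norm_inner_symm (tf (latticePoint β⁻¹ α⁻¹ _) γ)]
    exact (summable_sq_norm_inner_tf_right hBb γ).mul_left _
  have hsum := hB.summable_smul hc
  convert hsum.hasSum
  refine ext_inner_tf_gaussL2 fun t => ?_
  have hX := (hsum.hasSum.mapL (innerSL ℂ (tf t gaussL2))).tsum_eq
  simp only [innerSL_apply_apply, inner_smul_right, mul_assoc] at hX
  rw [← hX, tsum_mul_left]
  refine Eq.trans ?_ (gaborSum_eq_dual hα hβ (hg.isBessel hα hβ) hBb γ t)
  have hcomm (n : ℤ × ℤ) : tf (latticePoint α β n) (tf b g) = tf b (tf (latticePoint α β n) g) := by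
    have h₁ : b.2 * (latticePoint α β n).1 = ((s * n.1 : ℤ) : ℝ) := by
      simp only [hb, latticePoint]
      push_cast
      field_simp
    rw [tf_tf, tf_tf, h₁, expChar_intCast, hb, mul_zero, expChar_zero, add_comm]
  have hsum' := ((hγ.mapL (innerSL ℂ (tf (-b) (tf t gaussL2)))).mul_left
    (expChar (-(b.1 * b.2)))).tsum_eq
  simp only [innerSL_apply_apply, inner_smul_right] at hsum'
  rw [inner_tf_right, ← hsum', gaborSum]
  congr 1 with n
  rw [inner_tf_dual_window hγ, hcomm, inner_tf_right b]
  ring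

/-- Integer coordinates on the separable lattice `αℤ × βℤ`. -/
def sepLatticeEquiv {α β : ℝ} (hα : α ≠ 0) (hβ : β ≠ 0) : ℤ × ℤ ≃ sepLattice α β :=
  Equiv.ofBijective (fun n => ⟨latticePoint α β n, n.1, n.2, rfl⟩) <| by
    refine ⟨fun m n h => ?_, ?_⟩
    · have h' := congrArg Subtype.val h
      simp only [latticePoint, Prod.mk.injEq, mul_right_inj' hα, mul_right_inj' hβ,
        Int.cast_inj] at h'
      exact Prod.ext h'.1 h'.2
    · rintro ⟨_, k, l, rfl⟩
      exact ⟨(k, l), rfl⟩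

lemma IsDualWindow.hasSum {g γ : L2} {α β : ℝ} (hγ : IsDualWindow g γ α β) (hα : α ≠ 0)
    (hβ : β ≠ 0) :
    HasSum (fun n => ⟪tf (latticePoint α β n) g, γ⟫_ℂ • tf (latticePoint α β n) g) g :=
  (sepLatticeEquiv hα hβ).hasSum_iff.2 hγ.2

/-- Splitting the second coordinate according to its residue modulo `ν`. -/
def residueEquiv (ν : ℕ) [NeZero ν] : Fin ν × (ℤ × ℤ) ≃ ℤ × ℤ :=
  (Equiv.prodComm _ _).trans <| (Equiv.prodAssoc _ _ _).trans <|
    (Equiv.refl ℤ).prodCongr (Int.divModEquiv ν).symm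

lemma residueEquiv_apply (ν : ℕ) [NeZero ν] (r : Fin ν) (kl : ℤ × ℤ) :
    residueEquiv ν (r, kl) = (kl.1, kl.2 * ν + r) := by
  simp [residueEquiv, Int.divModEquiv]

lemma tf_mem_Lsub (g : L2) (α β : ℝ) (ν s : ℕ) (k l : ℤ) :
    tf ((k : ℝ) / β, ((l : ℝ) * (ν : ℝ) + (s : ℝ)) / α) g ∈ Lsub g α β ν s :=
  Submodule.le_topologicalClosure _ (Submodule.subset_span ⟨k, l, rfl⟩)

lemma Mo_mem_Lsub (g : L2) (α β : ℝ) (ν s : ℕ) : Mo ((s : ℝ) / α) g ∈ Lsub g α β ν s := by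
  have h := tf_mem_Lsub g α β ν s 0 0
  simpa [tf_zero_left] using h

/-- (iii) ⇒ (ii) of Theorem 4.4: if `𝒦 = ℒ_0 ∔ ⋯ ∔ ℒ_{ν-1}`,
then the projection conditions hold. -/
theorem statement_13 (g : L2) (hg : InS0 g) (α β : ℝ) (hα : 0 < α) (hβ : 0 < β)
    (hframe : IsFrameSeq g (sepLattice α β)) (γ : L2) (hγ : IsDualWindow g γ α β)
    (ν : ℕ) (hν : 1 ≤ ν)
    (hdirect : Ksub g α β = (⨆ s : Fin ν, Lsub g α β ν s) ∧
      ∀ i : Fin ν,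
        Lsub g α β ν i ⊓ (⨆ j : Fin ν, ⨆ _ : j ≠ i, Lsub g α β ν j) = ⊥) :
    ∀ s : ℕ, s < ν →
      HasSum (fun kl : ℤ × ℤ =>
        ((((α * β)⁻¹ : ℝ) : ℂ) *
            ⟪tf ((kl.1 : ℝ) / β, (kl.2 : ℝ) * (ν : ℝ) / α) γ, Mo ((s : ℝ) / α) g⟫_ℂ)
          • tf ((kl.1 : ℝ) / β, (kl.2 : ℝ) * (ν : ℝ) / α) g)
        (if s = 0 then g else 0) := by
  intro s hs
  have : NeZero ν := ⟨by omega⟩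
  set c : ℂ := (((α * β)⁻¹ : ℝ) : ℂ)
  set F : Fin ν × (ℤ × ℤ) → L2 := fun x =>
    (c * ⟪tf ((x.2.1 : ℝ) / β, ((x.2.2 : ℝ) * (ν : ℝ) + ((x.1 : ℕ) : ℝ)) / α) γ,
      Mo ((s : ℝ) / α) g⟫_ℂ) •
        tf ((x.2.1 : ℝ) / β, ((x.2.2 : ℝ) * (ν : ℝ) + ((x.1 : ℕ) : ℝ)) / α) g with hF
  have hsum : HasSum F (Mo ((s : ℝ) / α) g) := by
    have h := (residueEquiv ν).hasSum_iff.2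
      (hasSum_adjoint_lattice hg hα hβ (hγ.hasSum hα.ne' hβ.ne') s)
    rw [Int.cast_natCast] at h
    refine h.congr_fun fun x => ?_
    have hpt : latticePoint β⁻¹ α⁻¹ (residueEquiv ν x)
        = ((x.2.1 : ℝ) / β, ((x.2.2 : ℝ) * (ν : ℝ) + ((x.1 : ℕ) : ℝ)) / α) := by
      rw [residueEquiv_apply ν x.1 x.2, latticePoint]
      push_cast
      simp only [div_eq_inv_mul]
    simp only [hF, Function.comp_apply, hpt, c]
  set Q : Fin ν → L2 := fun r => ∑' kl, F (r, kl) with hQ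
  have hQsum (r : Fin ν) : HasSum (fun kl => F (r, kl)) (Q r) :=
    (hsum.summable.prod_factor r).hasSum
  have hQmem (r : Fin ν) : Q r ∈ Lsub g α β ν r := by
    refine (Submodule.isClosed_topologicalClosure _).mem_of_tendsto (hQsum r)
      (Eventually.of_forall fun t => ?_)
    exact Submodule.sum_mem _ fun kl _ => Submodule.smul_mem _ _ (tf_mem_Lsub g α β ν r kl.1 kl.2)
  have htotal : ∑ r, Q r = Mo ((s : ℝ) / α) g :=
    (hasSum_fintype Q).unique (hsum.prod_fiberwise hQsum)
  rw [← Finset.add_sum_erase _ _ (Finset.mem_univ (0 : Fin ν))] at htotal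
  have hrest : ∑ r ∈ Finset.univ.erase (0 : Fin ν), Q r ∈
      ⨆ j : Fin ν, ⨆ _ : j ≠ 0, Lsub g α β ν j :=
    Submodule.sum_mem _ fun r hr =>
      Submodule.mem_iSup_of_mem r (Submodule.mem_iSup_of_mem (Finset.ne_of_mem_erase hr) (hQmem r))
  have hmain : Q 0 = if s = 0 then g else 0 := by
    have hbot {x : L2} (h₁ : x ∈ Lsub g α β ν (0 : Fin ν))
        (h₂ : x ∈ ⨆ j : Fin ν, ⨆ _ : j ≠ 0, Lsub g α β ν j) : x = 0 := by
      have := Submodule.mem_inf.2 ⟨h₁, h₂⟩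
      rwa [hdirect.2 0, Submodule.mem_bot] at this
    split_ifs with h0
    · subst h0
      have hMo : Mo (((0 : ℕ) : ℝ) / α) g = g := by
        rw [← tf_zero_left, Nat.cast_zero, zero_div]
        exact tf_zero g
      have hmem := Mo_mem_Lsub g α β ν 0
      rw [hMo] at htotal hmem
      refine sub_eq_zero.1 (hbot (Submodule.sub_mem _ (hQmem 0) (by simpa using hmem)) ?_)
      have hneg : Q 0 - g = -∑ r ∈ Finset.univ.erase (0 : Fin ν), Q r := by
        rw [eq_sub_of_add_eq htotal, sub_sub_cancel_left]
      rw [hneg]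
      exact Submodule.neg_mem _ hrest
    · refine hbot (hQmem 0) ?_
      rw [eq_sub_of_add_eq htotal]
      refine Submodule.sub_mem _ (Submodule.mem_iSup_of_mem ⟨s, hs⟩
        (Submodule.mem_iSup_of_mem ?_ (Mo_mem_Lsub g α β ν s))) hrest
      simpa [Fin.ext_iff] using h0
  have h := hQsum 0
  rw [hmain] at h
  simpa [hF] using h

end
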